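/- Let d ∈ {1,2,3}, let Ω ⊆ ℝ^d be a nonempty bounded open set, let b, c > 0 and k, σ ∈ ℝ. If ψ is admissible and solves the Blackstock equation ψ_tt − c²(1 − 2k ψ_t)Δψ − b Δψ_t + 2σ ∇ψ·∇ψ_t = 0 on an open time interval I × Ω, then for every t ∈ I the function F₃(t) := ∫_Ω (c² ∇ψ(t)·∇ψ_t(t) + (b/2)|∇ψ_t(t)|²) is differentiable and F₃′(t) + ∫_Ω ψ_tt(t)² = c² ∫_Ω |∇ψ_t(t)|² + ∫_Ω ψ_tt(t) f(t), where f := −2k c² ψ_t Δψ − 2σ ∇ψ·∇ψ_t. -/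

import Mathlib

open MeasureTheory Real

noncomputable section

/-- Euclidean space ℝ^d. -/
abbrev Spc (d : ℕ) := EuclideanSpace ℝ (Fin d)

variable {d : ℕ}

/-- Spatial Laplacian: sum of second derivatives in the coordinate directions. -/
def lap (g : Spc d → ℝ) (x : Spc d) : ℝ :=
  ∑ i, fderiv ℝ (fun y => fderiv ℝ g y (EuclideanSpace.single i 1)) x (EuclideanSpace.single i 1)

/-- Squared L²(Ω) norm: ‖g‖² = ∫_Ω g². -/
def sqL2 (Ω : Set (Spc d)) (g : Spc d → ℝ) : ℝ := ∫ x in Ω, (g x) ^ 2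

/-- Squared L²(Ω) norm of the gradient: ‖∇g‖² = ∫_Ω |∇g|². -/
def sqGrad (Ω : Set (Spc d)) (g : Spc d → ℝ) : ℝ := ∫ x in Ω, ‖gradient g x‖ ^ 2

/-- Squared L²(Ω) norm of the Hessian: ‖D²g‖² = ∫_Ω |D²g|². -/
def sqHess (Ω : Set (Spc d)) (g : Spc d → ℝ) : ℝ := ∫ x in Ω, ‖iteratedFDeriv ℝ 2 g x‖ ^ 2

/-- Squared H¹(Ω) norm. -/
def sqH1 (Ω : Set (Spc d)) (g : Spc d → ℝ) : ℝ := sqL2 Ω g + sqGrad Ω g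

/-- Squared H²(Ω) norm. -/
def sqH2 (Ω : Set (Spc d)) (g : Spc d → ℝ) : ℝ := sqL2 Ω g + sqGrad Ω g + sqHess Ω g

/-- H⁻¹(Ω) norm by duality against smooth compactly supported test functions. -/
def negH1 (Ω : Set (Spc d)) (g : Spc d → ℝ) : ℝ :=
  sSup { r : ℝ | ∃ φ : Spc d → ℝ, ContDiff ℝ (⊤ : ℕ∞) φ ∧ HasCompactSupport φ ∧ tsupport φ ⊆ Ω ∧
      (∫ x in Ω, ‖gradient φ x‖ ^ 2) ≤ 1 ∧ r = ∫ x in Ω, g x * φ x }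

/-- Admissible: smooth in (t,x), with spatial support in a fixed compact subset of Ω. -/
def Admissible (Ω : Set (Spc d)) (w : ℝ → Spc d → ℝ) : Prop :=
  ContDiff ℝ (⊤ : ℕ∞) (fun p : ℝ × Spc d => w p.1 p.2) ∧
  ∃ K : Set (Spc d), IsCompact K ∧ K ⊆ Ω ∧ ∀ t, Function.support (w t) ⊆ K

/-- Inner product of two spatial gradients: ∇g·∇h. -/
def gdot (g h : Spc d → ℝ) (x : Spc d) : ℝ := @inner ℝ _ _ (gradient g x) (gradient h x)

/-- Time derivative. -/
def tderiv (w : ℝ → Spc d → ℝ) (t : ℝ) (x : Spc d) : ℝ := deriv (fun s => w s x) t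

/-- The Blackstock equation ψ_tt − c²(1 − 2k ψ_t)Δψ − b Δψ_t + 2σ ∇ψ·∇ψ_t = 0
holds at time `t` on `Ω`. -/
def IsBlackstock (Ω : Set (Spc d)) (b c k σ : ℝ) (ψ : ℝ → Spc d → ℝ) (t : ℝ) : Prop :=
  ∀ x ∈ Ω,
    (tderiv (tderiv ψ) t x - c ^ 2 * (1 - 2 * k * tderiv ψ t x) * lap (ψ t) x
      - b * lap (tderiv ψ t) x
      + 2 * σ * gdot (ψ t) (tderiv ψ t) x) = 0

/-- Energy E(t). -/
def energy (Ω : Set (Spc d)) (b c : ℝ) (ψ : ℝ → Spc d → ℝ) (t : ℝ) : ℝ :=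
  (1 / 2) * sqL2 Ω (tderiv ψ t) + (c ^ 2 / 2) * sqGrad Ω (ψ t)
    + (c ^ 2 / (2 * b)) * sqL2 Ω (lap (ψ t)) + sqGrad Ω (tderiv ψ t)

/-- Dissipation D(t). -/
def dissip (Ω : Set (Spc d)) (ψ : ℝ → Spc d → ℝ) (t : ℝ) : ℝ :=
  ∫ s in (0:ℝ)..t,
    (sqGrad Ω (tderiv ψ s) + sqL2 Ω (lap (tderiv ψ s)) + sqGrad Ω (ψ s)
      + sqL2 Ω (lap (ψ s)) + sqL2 Ω (tderiv (tderiv ψ) s))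

/-- Supremum of a function of time over [0,T]. -/
def supIcc (T : ℝ) (f : ℝ → ℝ) : ℝ := ⨆ t : Set.Icc (0:ℝ) T, f t

/-- f := −2k c² ψ_t Δψ − 2σ ∇ψ·∇ψ_t, the right-hand side nonlinearity. -/
def blackF (c k σ : ℝ) (ψ : ℝ → Spc d → ℝ) (t : ℝ) (x : Spc d) : ℝ :=
  -(2 * k * c ^ 2) * tderiv ψ t x * lap (ψ t) x - 2 * σ * gdot (ψ t) (tderiv ψ t) x

/-- The nonlocal heat equation v_t − b Δv − c² Δψ = f (with v = ψ_t) holds at time `t` on `Ω`. -/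
def IsHeat (Ω : Set (Spc d)) (b c : ℝ) (ψ f : ℝ → Spc d → ℝ) (t : ℝ) : Prop :=
  ∀ x ∈ Ω,
    tderiv (tderiv ψ) t x - b * lap (tderiv ψ t) x - c ^ 2 * lap (ψ t) x = f t x

/-- The linearized Blackstock equation
ψ_tt − c²(1 − 2k α)Δψ − b Δψ_t + 2σ ∇ψ·∇α = f̃ holds at time `t` on `Ω`. -/
def IsLinBlackstock (Ω : Set (Spc d)) (b c k σ : ℝ) (α ψ f : ℝ → Spc d → ℝ) (t : ℝ) : Prop :=
  ∀ x ∈ Ω,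
    tderiv (tderiv ψ) t x - c ^ 2 * (1 - 2 * k * α t x) * lap (ψ t) x
      - b * lap (tderiv ψ t) x + 2 * σ * gdot (ψ t) (α t) x = f t x

/-- Time-weighted norm N_T^v for the velocity variable. -/
def normV (Ω : Set (Spc d)) (T : ℝ) (α : ℝ → Spc d → ℝ) : ℝ :=
  supIcc T (fun t => Real.sqrt (sqH1 Ω (α t)))
    + Real.sqrt (∫ t in (0:ℝ)..T, (sqL2 Ω (α t) + sqGrad Ω (α t) + sqL2 Ω (lap (α t))))
    + Real.sqrt (∫ t in (0:ℝ)..T, sqL2 Ω (tderiv α t))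
    + supIcc T (fun t => Real.sqrt t * Real.sqrt (sqL2 Ω (tderiv α t)))
    + Real.sqrt (∫ t in (0:ℝ)..T, t * sqGrad Ω (tderiv α t))
    + supIcc T (fun t => Real.sqrt t * Real.sqrt (sqL2 Ω (lap (α t))))

/-- Time-weighted solution norm N_T(ψ) = sup_{[0,T]} ‖ψ(t)‖_{H²} + N_T^v(ψ_t). -/
def normX (Ω : Set (Spc d)) (T : ℝ) (ψ : ℝ → Spc d → ℝ) : ℝ :=
  supIcc T (fun t => Real.sqrt (sqH2 Ω (ψ t))) + normV Ω T (tderiv ψ)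

/-- Spatial partial derivative. -/
def pxx (i : Fin d) (w : ℝ → Spc d → ℝ) (t : ℝ) (x : Spc d) : ℝ :=
  fderiv ℝ (w t) x (EuclideanSpace.single i 1)

theorem tderiv_eq {w : ℝ → Spc d → ℝ}
    (h : ContDiff ℝ (⊤ : ℕ∞) (fun p : ℝ × Spc d => w p.1 p.2)) (t : ℝ) (x : Spc d) :
    HasDerivAt (fun s => w s x) (fderiv ℝ (fun p : ℝ × Spc d => w p.1 p.2) (t, x) (1, 0)) t := by
  have h1 : HasFDerivAt (fun p : ℝ × Spc d => w p.1 p.2) _ (t, x) :=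
    (h.differentiable (by simp) (t, x)).hasFDerivAt
  have h2 : HasDerivAt (fun s : ℝ => (s, x)) ((1 : ℝ), (0 : Spc d)) t :=
    (hasDerivAt_id t).prodMk (hasDerivAt_const t x)
  exact h1.comp_hasDerivAt t h2

theorem pxx_eq {w : ℝ → Spc d → ℝ}
    (h : ContDiff ℝ (⊤ : ℕ∞) (fun p : ℝ × Spc d => w p.1 p.2)) (i : Fin d) (t : ℝ) (x : Spc d) :
    pxx i w t x = fderiv ℝ (fun p : ℝ × Spc d => w p.1 p.2) (t, x)
      (0, EuclideanSpace.single i 1) := by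
  have h1 : HasFDerivAt (fun p : ℝ × Spc d => w p.1 p.2) _ (t, x) :=
    (h.differentiable (by simp) (t, x)).hasFDerivAt
  have h2 : HasFDerivAt (fun y : Spc d => (t, y)) _ x :=
    (hasFDerivAt_const (𝕜 := ℝ) t x).prodMk (hasFDerivAt_id (𝕜 := ℝ) x)
  have h3 : HasFDerivAt (w t) _ x := h1.comp x h2
  unfold pxx
  rw [h3.fderiv]
  simp

theorem dir_smooth {W : ℝ × Spc d → ℝ} (h : ContDiff ℝ (⊤ : ℕ∞) W) (v : ℝ × Spc d) :
    ContDiff ℝ (⊤ : ℕ∞) (fun p => fderiv ℝ W p v) :=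
  (h.fderiv_right (m := (⊤ : ℕ∞)) (by simp)).clm_apply contDiff_const

theorem dir_comm {W : ℝ × Spc d → ℝ} (h : ContDiff ℝ (⊤ : ℕ∞) W) (u v p : ℝ × Spc d) :
    fderiv ℝ (fun p => fderiv ℝ W p u) p v = fderiv ℝ (fun p => fderiv ℝ W p v) p u := by
  have hd : DifferentiableAt ℝ (fderiv ℝ W) p :=
    (h.fderiv_right (m := (⊤ : ℕ∞)) (by simp)).differentiable (by simp) p
  have hs : IsSymmSndFDerivAt ℝ W p := h.contDiffAt.isSymmSndFDerivAt (by
    simp only [minSmoothness_of_isRCLikeNormedField]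
    exact WithTop.coe_le_coe.2 (le_top : (2 : ℕ∞) ≤ ⊤))
  have e : ∀ u v : ℝ × Spc d,
      fderiv ℝ (fun p => fderiv ℝ W p u) p v = fderiv ℝ (fderiv ℝ W) p v u := by
    intro u v
    have := (hd.hasFDerivAt.clm_apply (hasFDerivAt_const u p)).fderiv
    rw [this]; simp
  rw [e, e, hs]

variable {Ω : Set (Spc d)} {w w₁ w₂ : ℝ → Spc d → ℝ}

theorem Admissible.tderiv (h : Admissible Ω w) : Admissible Ω (tderiv w) := by
  obtain ⟨hs, K, hK, hKΩ, hsup⟩ := h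
  refine ⟨?_, K, hK, hKΩ, ?_⟩
  · have : (fun p : ℝ × Spc d => _root_.tderiv w p.1 p.2) = fun p =>
        fderiv ℝ (fun p : ℝ × Spc d => w p.1 p.2) p (1, 0) := by
      ext p; exact (tderiv_eq hs p.1 p.2).deriv
    rw [this]; exact dir_smooth hs _
  · intro t x hx
    by_contra hxK
    apply hx
    have : (fun s => w s x) = fun _ => 0 := by
      ext s
      by_contra h0
      exact hxK (hsup s h0)
    unfold _root_.tderiv
    rw [this]; simp

theorem Admissible.pxx (h : Admissible Ω w) (i : Fin d) : Admissible Ω (pxx i w) := by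
  obtain ⟨hs, K, hK, hKΩ, hsup⟩ := h
  refine ⟨?_, K, hK, hKΩ, ?_⟩
  · have : (fun p : ℝ × Spc d => _root_.pxx i w p.1 p.2) = fun p =>
        fderiv ℝ (fun p : ℝ × Spc d => w p.1 p.2) p (0, EuclideanSpace.single i 1) := by
      ext p; exact pxx_eq hs i p.1 p.2
    rw [this]; exact dir_smooth hs _
  · intro t x hx
    have h1 : x ∈ Function.support (fderiv ℝ (w t)) := by
      intro h0
      apply hx
      simp [_root_.pxx, h0]
    exact closure_minimal (hsup t) hK.isClosed (support_fderiv_subset ℝ h1)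

theorem Admissible.mul (h₁ : Admissible Ω w₁) (h₂ : Admissible Ω w₂) :
    Admissible Ω (fun t x => w₁ t x * w₂ t x) := by
  obtain ⟨hs, K, hK, hKΩ, hsup⟩ := h₁
  refine ⟨hs.mul h₂.1, K, hK, hKΩ, fun t x hx => hsup t ?_⟩
  intro h0
  apply hx
  simp [h0]

theorem Admissible.add (h₁ : Admissible Ω w₁) (h₂ : Admissible Ω w₂) :
    Admissible Ω (fun t x => w₁ t x + w₂ t x) := by
  obtain ⟨hs, K, hK, hKΩ, hsup⟩ := h₁
  obtain ⟨hs', K', hK', hKΩ', hsup'⟩ := h₂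
  refine ⟨hs.add hs', K ∪ K', hK.union hK', Set.union_subset hKΩ hKΩ', fun t x hx => ?_⟩
  by_contra hn
  simp only [Set.mem_union, not_or] at hn
  apply hx
  have a1 : w₁ t x = 0 := by by_contra h; exact hn.1 (hsup t h)
  have a2 : w₂ t x = 0 := by by_contra h; exact hn.2 (hsup' t h)
  simp [a1, a2]

theorem Admissible.cmul (h₁ : Admissible Ω w₁) (a : ℝ) :
    Admissible Ω (fun t x => a * w₁ t x) := by
  obtain ⟨hs, K, hK, hKΩ, hsup⟩ := h₁
  refine ⟨contDiff_const.mul hs, K, hK, hKΩ, fun t x hx => hsup t ?_⟩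
  intro h0
  apply hx
  simp [h0]

theorem Admissible.sum {ι : Type*} (s : Finset ι) {v : ι → ℝ → Spc d → ℝ}
    (h : ∀ i, Admissible Ω (v i)) : Admissible Ω (fun t x => ∑ i ∈ s, v i t x) := by
  classical
  induction s using Finset.induction_on with
  | empty =>
    refine ⟨by simpa using contDiff_const, ∅, isCompact_empty, Set.empty_subset _, ?_⟩
    intro t x hx
    simp at hx
  | insert a s ha ih =>
    simp only [Finset.sum_insert ha]
    exact (h a).add ih

theorem tderiv_pxx (h : Admissible Ω w) (i : Fin d) :
    tderiv (pxx i w) = pxx i (tderiv w) := by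
  have hp : (fun p : ℝ × Spc d => pxx i w p.1 p.2) = fun p =>
      fderiv ℝ (fun p : ℝ × Spc d => w p.1 p.2) p (0, EuclideanSpace.single i 1) := by
    ext p; exact pxx_eq h.1 i p.1 p.2
  have ht : (fun p : ℝ × Spc d => _root_.tderiv w p.1 p.2) = fun p =>
      fderiv ℝ (fun p : ℝ × Spc d => w p.1 p.2) p (1, 0) := by
    ext p; exact (tderiv_eq h.1 p.1 p.2).deriv
  ext t x
  rw [pxx_eq h.tderiv.1, ht]
  have := (tderiv_eq (h.pxx i).1 t x).deriv
  rw [hp] at this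
  exact this.trans (dir_comm h.1 _ _ _)

theorem Admissible.hasDerivAt (h : Admissible Ω w) (t : ℝ) (x : Spc d) :
    HasDerivAt (fun s => w s x) (_root_.tderiv w t x) t :=
  (tderiv_eq h.1 t x).differentiableAt.hasDerivAt

theorem Admissible.smooth_slice (h : Admissible Ω w) (t : ℝ) : ContDiff ℝ (⊤ : ℕ∞) (w t) :=
  h.1.comp (contDiff_const.prodMk contDiff_id)

theorem Admissible.hasCompactSupport (h : Admissible Ω w) (t : ℝ) :
    HasCompactSupport (w t) := by
  obtain ⟨hs, K, hK, hKΩ, hsup⟩ := h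
  exact HasCompactSupport.of_support_subset_isCompact hK (hsup t)

theorem Admissible.integrable (h : Admissible Ω w) (t : ℝ) : Integrable (w t) :=
  (h.smooth_slice t).continuous.integrable_of_hasCompactSupport (h.hasCompactSupport t)

theorem Admissible.setIntegral (h : Admissible Ω w) (t : ℝ) :
    ∫ x in Ω, w t x = ∫ x, w t x := by
  obtain ⟨hs, K, hK, hKΩ, hsup⟩ := h
  refine setIntegral_eq_integral_of_forall_compl_eq_zero fun x hx => ?_
  by_contra h0
  exact hx (hKΩ (hsup t h0))

theorem Admissible.hasDerivAt_integral (h : Admissible Ω w) (t : ℝ) :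
    HasDerivAt (fun s => ∫ x in Ω, w s x) (∫ x in Ω, _root_.tderiv w t x) t := by
  simp only [h.setIntegral, h.tderiv.setIntegral]
  obtain ⟨hs, K, hK, hKΩ, hsup⟩ := h.tderiv
  obtain ⟨C, hC⟩ := ((isCompact_Icc (a := t - 1) (b := t + 1)).prod hK).exists_bound_of_continuousOn
    hs.continuous.continuousOn
  refine (hasDerivAt_integral_of_dominated_loc_of_deriv_le (bound := K.indicator fun _ => C)
    (s := Set.Icc (t - 1) (t + 1)) (Icc_mem_nhds (by linarith) (by linarith))
    (Filter.Eventually.of_forall fun s => (h.integrable s).aestronglyMeasurable)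
    (h.integrable t) (h.tderiv.integrable t).aestronglyMeasurable ?_ ?_ ?_).2
  · refine Filter.Eventually.of_forall fun x s hs => ?_
    by_cases hx : x ∈ K
    · rw [Set.indicator_of_mem hx]
      exact hC (s, x) ⟨hs, hx⟩
    · rw [Set.indicator_of_notMem hx]
      have : _root_.tderiv w s x = 0 := by
        by_contra h0
        exact hx (hsup s h0)
      simp [this]
  · exact (integrable_indicator_iff hK.measurableSet).2
      (integrableOn_const hK.measure_lt_top.ne)
  · exact Filter.Eventually.of_forall fun x s _ => h.hasDerivAt s x

theorem gdot_eq (g h : Spc d → ℝ) (x : Spc d) :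
    gdot g h x = ∑ i, fderiv ℝ g x (EuclideanSpace.single i 1) *
      fderiv ℝ h x (EuclideanSpace.single i 1) := by
  have e : ∀ (g : Spc d → ℝ) i, fderiv ℝ g x (EuclideanSpace.single i 1) = gradient g x i := by
    intro g i
    rw [← inner_gradient_left, EuclideanSpace.inner_single_right]
    simp
  simp only [e, gdot, PiLp.inner_apply]
  simp [mul_comm]

theorem ibp (h₁ : Admissible Ω w₁) (h₂ : Admissible Ω w₂) (t : ℝ) :
    ∫ x in Ω, ∑ i, pxx i w₁ t x * pxx i w₂ t x = -∫ x in Ω, w₂ t x * lap (w₁ t) x := by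
  have A : ∀ i : Fin d, Admissible Ω (fun t x => pxx i w₁ t x * pxx i w₂ t x) :=
    fun i => (h₁.pxx i).mul (h₂.pxx i)
  have B : ∀ i : Fin d, Admissible Ω (fun t x => w₂ t x * pxx i (pxx i w₁) t x) :=
    fun i => h₂.mul ((h₁.pxx i).pxx i)
  have e : ∀ x, w₂ t x * lap (w₁ t) x = ∑ i, w₂ t x * pxx i (pxx i w₁) t x := by
    intro x
    rw [← Finset.mul_sum]; rfl
  simp only [e]
  rw [integral_finsetSum _ fun i _ => ((A i).integrable t).integrableOn,
    integral_finsetSum _ fun i _ => ((B i).integrable t).integrableOn, ← Finset.sum_neg_distrib]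
  refine Finset.sum_congr rfl fun i _ => ?_
  rw [(A i).setIntegral t, (B i).setIntegral t]
  have key := integral_mul_fderiv_eq_neg_fderiv_mul_of_integrable
    (μ := (volume : Measure (Spc d))) (f := w₂ t) (g := pxx i w₁ t)
    (v := EuclideanSpace.single i 1)
    (((h₂.pxx i).mul (h₁.pxx i)).integrable t) ((B i).integrable t)
    ((h₂.mul (h₁.pxx i)).integrable t)
    (fun x _ => (h₂.smooth_slice t).differentiable (by simp) x)
    (fun x _ => ((h₁.pxx i).smooth_slice t).differentiable (by simp) x)
  have key' : ∫ x, w₂ t x * pxx i (pxx i w₁) t x = -∫ x, pxx i w₂ t x * pxx i w₁ t x := key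
  rw [key', neg_neg]
  simp only [mul_comm]

theorem int_lin {μ : Measure (Spc d)} {f g h : Spc d → ℝ} (hf : Integrable f μ)
    (hg : Integrable g μ) (hh : Integrable h μ) (p q r : ℝ) :
    ∫ x, (p * f x + q * g x + r * h x) ∂μ
      = p * (∫ x, f x ∂μ) + q * (∫ x, g x ∂μ) + r * (∫ x, h x ∂μ) := by
  have h1 : Integrable (fun x => p * f x + q * g x) μ := (hf.const_mul p).add (hg.const_mul q)
  rw [integral_add h1 (hh.const_mul r), integral_add (hf.const_mul p) (hg.const_mul q),
    integral_const_mul, integral_const_mul, integral_const_mul]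

/-- the identity F₃′(t) + ‖ψ_tt‖² = c²‖∇ψ_t‖² + ∫ ψ_tt f
for solutions of the Blackstock equation. -/
theorem blackstock_F3_identity (d : ℕ) (hd : d = 1 ∨ d = 2 ∨ d = 3)
    (Ω : Set (Spc d)) (hne : Ω.Nonempty) (hop : IsOpen Ω) (hbd : Bornology.IsBounded Ω)
    (b c k σ : ℝ) (hb : 0 < b) (hc : 0 < c)
    (I : Set ℝ) (hIo : IsOpen I) (hIc : I.OrdConnected)
    (ψ : ℝ → Spc d → ℝ) (hadm : Admissible Ω ψ)
    (hsol : ∀ t ∈ I, IsBlackstock Ω b c k σ ψ t) :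
    ∀ t ∈ I,
      HasDerivAt
        (fun s => ∫ x in Ω,
          (c ^ 2 * gdot (ψ s) (tderiv ψ s) x + (b/2) * ‖gradient (tderiv ψ s) x‖ ^ 2))
        (c ^ 2 * sqGrad Ω (tderiv ψ t)
          + (∫ x in Ω, tderiv (tderiv ψ) t x * blackF c k σ ψ t x)
          - sqL2 Ω (tderiv (tderiv ψ) t)) t := by
  intro t ht
  have h1 := hadm.tderiv
  have h2 := h1.tderiv
  have nrm : ∀ (s : ℝ) (x : Spc d) , ‖gradient (tderiv ψ s) x‖ ^ 2
      = ∑ i, pxx i (tderiv ψ) s x * pxx i (tderiv ψ) s x := by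
    intro s x
    rw [← real_inner_self_eq_norm_sq]
    exact gdot_eq _ _ x
  have gd : ∀ (s : ℝ) (x : Spc d) , gdot (ψ s) (tderiv ψ s) x
      = ∑ i, pxx i ψ s x * pxx i (tderiv ψ) s x := fun s x => gdot_eq _ _ x
  have P : Admissible Ω (fun s x => ∑ i, pxx i ψ s x * pxx i (tderiv ψ) s x) :=
    Admissible.sum _ fun i => (hadm.pxx i).mul (h1.pxx i)
  have Q : Admissible Ω (fun s x => ∑ i, pxx i (tderiv ψ) s x * pxx i (tderiv ψ) s x) :=
    Admissible.sum _ fun i => (h1.pxx i).mul (h1.pxx i)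
  have R1 : Admissible Ω (fun s x => ∑ i, pxx i ψ s x * pxx i (tderiv (tderiv ψ)) s x) :=
    Admissible.sum _ fun i => (hadm.pxx i).mul (h2.pxx i)
  have R2 : Admissible Ω
      (fun s x => ∑ i, pxx i (tderiv ψ) s x * pxx i (tderiv (tderiv ψ)) s x) :=
    Admissible.sum _ fun i => (h1.pxx i).mul (h2.pxx i)
  have key := ((P.cmul (c ^ 2)).add (Q.cmul (b / 2))).hasDerivAt_integral t
  simp only [gd, nrm, sqGrad, sqL2]
  convert key using 1
  have td : ∀ x, tderiv (fun s x => c ^ 2 * (∑ i, pxx i ψ s x * pxx i (tderiv ψ) s x)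
        + b / 2 * ∑ i, pxx i (tderiv ψ) s x * pxx i (tderiv ψ) s x) t x
      = c ^ 2 * (∑ i, pxx i (tderiv ψ) t x * pxx i (tderiv ψ) t x)
        + c ^ 2 * (∑ i, pxx i ψ t x * pxx i (tderiv (tderiv ψ)) t x)
        + b * (∑ i, pxx i (tderiv ψ) t x * pxx i (tderiv (tderiv ψ)) t x) := by
    intro x
    have d0 : ∀ i, HasDerivAt (fun s => pxx i ψ s x) (pxx i (tderiv ψ) t x) t := fun i => by
      rw [← tderiv_pxx hadm]; exact (hadm.pxx i).hasDerivAt t x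
    have d1 : ∀ i, HasDerivAt (fun s => pxx i (tderiv ψ) s x)
        (pxx i (tderiv (tderiv ψ)) t x) t := fun i => by
      rw [← tderiv_pxx h1]; exact (h1.pxx i).hasDerivAt t x
    have D := ((HasDerivAt.fun_sum (u := Finset.univ) fun i _ => (d0 i).mul (d1 i)).const_mul
      (c ^ 2)).add
      ((HasDerivAt.fun_sum (u := Finset.univ) fun i _ => (d1 i).mul (d1 i)).const_mul (b / 2))
    refine D.deriv.trans ?_
    simp only [Finset.sum_add_distrib, mul_comm (pxx _ (tderiv (tderiv ψ)) t x)]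
    ring
  simp only [td]
  have iQ := (Q.integrable t).integrableOn (s := Ω)
  have i1 := (R1.integrable t).integrableOn (s := Ω)
  have i2 := (R2.integrable t).integrableOn (s := Ω)
  have L : ∀ v : ℝ → Spc d → ℝ, Admissible Ω v →
      Integrable (fun x => tderiv (tderiv ψ) t x * lap (v t) x) (volume.restrict Ω) := by
    intro v hv
    exact ((h2.mul (Admissible.sum Finset.univ fun i =>
      (hv.pxx i).pxx i)).integrable t).integrableOn
  have iS : Integrable (fun x => tderiv (tderiv ψ) t x ^ 2) (volume.restrict Ω) := by
    simp only [sq]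
    exact ((h2.mul h2).integrable t).integrableOn (s := Ω)
  have B : ∫ x in Ω, tderiv (tderiv ψ) t x * blackF c k σ ψ t x
      = (∫ x in Ω, tderiv (tderiv ψ) t x ^ 2)
        - c ^ 2 * (∫ x in Ω, tderiv (tderiv ψ) t x * lap (ψ t) x)
        - b * (∫ x in Ω, tderiv (tderiv ψ) t x * lap (tderiv ψ t) x) := by
    have E := int_lin iS (L _ hadm) (L _ h1) 1 (-c ^ 2) (-b)
    refine Eq.trans ?_ (E.trans (by ring))
    refine setIntegral_congr_fun hop.measurableSet fun x hx => ?_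
    have := hsol t ht x hx
    simp only [blackF]
    linear_combination (-tderiv (tderiv ψ) t x) * this
  rw [B, int_lin iQ i1 i2, ibp hadm h2, ibp h1 h2]
  ring
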